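/- (Special case with a single power term.) Let D be a convex subset of a real normed space, c > 0, p, q ≥ 0, and let f : D → ℝ be hemi-Lebesgue integrable satisfying f((1−t)x+ty) ≤ (1−t)f(x) + t f(y) + c·t^p(1−t)^q‖x−y‖^{p+q−1} for all x ≠ y in D and t ∈ [0,1]. Then f((x+y)/2) ≤ ∫₀¹ f((1−t)x+ty) dt + c·‖x−y‖^{p+q−1}/(2^{p+q−1}(p+1)(q+1)) for all x ≠ y in D. -/

import Mathlib

open MeasureTheory intervalIntegral Real

/-- single power term: if
`f((1−t)x+ty) ≤ (1−t)f(x)+tf(y) + c·t^p(1−t)^q‖x−y‖^{p+q−1}`, then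
`f((x+y)/2) ≤ ∫₀¹ f((1−t)x+ty) dt + c·‖x−y‖^{p+q−1}/(2^{p+q−1}(p+1)(q+1))`. -/
theorem approx_lower_hh_single_power
    {X : Type*} [NormedAddCommGroup X] [NormedSpace ℝ X]
    (D : Set X) (hD : Convex ℝ D)
    (c p q : ℝ) (hc : 0 < c) (hp : 0 ≤ p) (hq : 0 ≤ q)
    (f : X → ℝ)
    (hf : ∀ x ∈ D, ∀ y ∈ D,
        IntervalIntegrable (fun t => f ((1 - t) • x + t • y)) volume 0 1)
    (hconv : ∀ x ∈ D, ∀ y ∈ D, x ≠ y → ∀ t ∈ Set.Icc (0:ℝ) 1,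
        f ((1 - t) • x + t • y) ≤ (1 - t) * f x + t * f y +
          c * (t ^ p * (1 - t) ^ q * ‖x - y‖ ^ (p + q - 1))) :
    ∀ x ∈ D, ∀ y ∈ D, x ≠ y →
      f ((2⁻¹ : ℝ) • (x + y)) ≤
        (∫ t in (0:ℝ)..1, f ((1 - t) • x + t • y)) +
        c * ‖x - y‖ ^ (p + q - 1) / ((2:ℝ) ^ (p + q - 1) * (p + 1) * (q + 1)) := by
  intro x hx y hy hxy
  set L : ℝ := ‖x - y‖ ^ (p + q - 1) with hL
  set g : ℝ → ℝ := fun t => f ((1 - t) • x + t • y) with hg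
  have hgi : IntervalIntegrable g volume 0 1 := hf x hx y hy
  have hmid : f ((2⁻¹ : ℝ) • (x + y)) = g (1/2) := by
    simp only [hg]
    congr 1
    rw [smul_add]
    norm_num
  have hkey : ∀ a ∈ Set.Ioo (0:ℝ) (1/2), ∀ b ∈ Set.Ioo (0:ℝ) (1/2),
      (a + b) * g (1/2) ≤ b * g (1/2 - a) + a * g (1/2 + b) + c * L * (a ^ p * b ^ q) := by
    intro a ha b hb
    obtain ⟨ha0, ha1⟩ := ha
    obtain ⟨hb0, hb1⟩ := hb
    have hab : 0 < a + b := by linarith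
    have hu : (1 - (1/2 - a)) • x + (1/2 - a) • y ∈ D :=
      hD hx hy (by linarith) (by linarith) (by ring)
    have hv : (1 - (1/2 + b)) • x + (1/2 + b) • y ∈ D :=
      hD hx hy (by linarith) (by linarith) (by ring)
    have hsub : ((1 - (1/2 - a)) • x + (1/2 - a) • y) - ((1 - (1/2 + b)) • x + (1/2 + b) • y)
        = (a + b) • (x - y) := by module
    have hxy0 : x - y ≠ 0 := sub_ne_zero.mpr hxy
    have hne : ((1 - (1/2 - a)) • x + (1/2 - a) • y) ≠ ((1 - (1/2 + b)) • x + (1/2 + b) • y) := by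
      rw [← sub_ne_zero, hsub]
      exact smul_ne_zero hab.ne' hxy0
    have h1t : 1 - a / (a + b) = b / (a + b) := by field_simp; ring
    have h := hconv _ hu _ hv hne (a / (a + b))
      ⟨by positivity, by rw [div_le_one hab]; linarith⟩
    rw [hsub, norm_smul, Real.norm_of_nonneg hab.le, Real.mul_rpow hab.le (norm_nonneg _), h1t,
      Real.div_rpow ha0.le hab.le, Real.div_rpow hb0.le hab.le, Real.rpow_sub hab,
      Real.rpow_add hab, Real.rpow_one] at h
    have hpt : (b / (a + b)) • ((1 - (1/2 - a)) • x + (1/2 - a) • y)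
        + (a / (a + b)) • ((1 - (1/2 + b)) • x + (1/2 + b) • y)
        = (1 - (1/2:ℝ)) • x + (1/2:ℝ) • y := by
      simp only [smul_add, smul_smul]
      rw [add_add_add_comm, ← add_smul, ← add_smul]
      congr 2
      · field_simp; ring
      · field_simp; ring
    rw [hpt] at h
    change g (1/2) ≤ b / (a + b) * g (1/2 - a) + a / (a + b) * g (1/2 + b) + _ at h
    rw [← hL] at h
    have hP : (a + b) ^ p ≠ 0 := (Real.rpow_pos_of_pos hab p).ne'
    have hQ : (a + b) ^ q ≠ 0 := (Real.rpow_pos_of_pos hab q).ne'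
    have h2 := mul_le_mul_of_nonneg_left h hab.le
    refine h2.trans (le_of_eq ?_)
    field_simp
  have hp1 : 0 < p + 1 := by linarith
  have hq1 : 0 < q + 1 := by linarith
  have hIp : ∫ a in (0:ℝ)..(1/2), a ^ p = (1/2:ℝ) ^ (p+1) / (p+1) := by
    rw [integral_rpow (Or.inl (by linarith)), Real.zero_rpow hp1.ne', sub_zero]
  have hIq : ∫ a in (0:ℝ)..(1/2), a ^ q = (1/2:ℝ) ^ (q+1) / (q+1) := by
    rw [integral_rpow (Or.inl (by linarith)), Real.zero_rpow hq1.ne', sub_zero]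
  have hip : IntervalIntegrable (fun a : ℝ => a ^ p) volume 0 (1/2) :=
    intervalIntegral.intervalIntegrable_rpow' (by linarith)
  have hiq : IntervalIntegrable (fun a : ℝ => a ^ q) volume 0 (1/2) :=
    intervalIntegral.intervalIntegrable_rpow' (by linarith)
  have hg1 : IntervalIntegrable g volume 0 (1/2) := hgi.mono_set (by
    rw [Set.uIcc_of_le (by norm_num), Set.uIcc_of_le (by norm_num)]
    exact Set.Icc_subset_Icc (by norm_num) (by norm_num))
  have hg2 : IntervalIntegrable g volume (1/2) 1 := hgi.mono_set (by
    rw [Set.uIcc_of_le (by norm_num), Set.uIcc_of_le (by norm_num)]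
    exact Set.Icc_subset_Icc (by norm_num) (by norm_num))
  have hA : IntervalIntegrable (fun a => g (1/2 - a)) volume 0 (1/2) := by
    have := (hg1.comp_sub_left (1/2)).symm
    norm_num at this ⊢
    exact this
  have hB : IntervalIntegrable (fun b => g (1/2 + b)) volume 0 (1/2) := by
    have := hg2.comp_add_left (1/2)
    norm_num at this ⊢
    exact this
  have hAe : ∫ a in (0:ℝ)..(1/2), g (1/2 - a) = ∫ t in (0:ℝ)..(1/2), g t := by
    rw [intervalIntegral.integral_comp_sub_left]; norm_num
  have hBe : ∫ a in (0:ℝ)..(1/2), g (1/2 + a) = ∫ t in (1/2:ℝ)..1, g t := by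
    rw [intervalIntegral.integral_comp_add_left]; norm_num
  have hsum : (∫ t in (0:ℝ)..(1/2), g t) + ∫ t in (1/2:ℝ)..1, g t = ∫ t in (0:ℝ)..1, g t :=
    intervalIntegral.integral_add_adjacent_intervals hg1 hg2
  have hid : ∫ a in (0:ℝ)..(1/2), a = 1/8 := by rw [integral_id]; norm_num
  have hidi : IntervalIntegrable (fun a : ℝ => a) volume 0 (1/2) :=
    continuous_id.intervalIntegrable _ _
  set A := ∫ t in (0:ℝ)..(1/2), g t
  set B := ∫ t in (1/2:ℝ)..1, g t
  set P := (1/2:ℝ) ^ (p+1) / (p+1) with hPdef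
  set Q := (1/2:ℝ) ^ (q+1) / (q+1) with hQdef
  have hstep : ∀ b ∈ Set.Ioo (0:ℝ) (1/2),
      (1/8) * g (1/2) + b * (1/2 * g (1/2)) ≤ b * A + 1/8 * g (1/2 + b) + c * L * P * b ^ q := by
    intro b hb
    have h := intervalIntegral.integral_mono_on_of_le_Ioo (μ := volume) (a := 0) (b := 1/2)
      (f := fun a => a * g (1/2) + b * g (1/2))
      (g := fun a => b * g (1/2 - a) + a * g (1/2 + b) + (c * L * b ^ q) * a ^ p)
      (by norm_num)
      ((hidi.mul_const _).add intervalIntegrable_const)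
      (((hA.const_mul _).add (hidi.mul_const _)).add (hip.const_mul _))
      (fun a ha => by have := hkey a ha b hb; linarith)
    rw [intervalIntegral.integral_add (hidi.mul_const _) intervalIntegrable_const,
      intervalIntegral.integral_add ((hA.const_mul _).add (hidi.mul_const _)) (hip.const_mul _),
      intervalIntegral.integral_add (hA.const_mul _) (hidi.mul_const _),
      intervalIntegral.integral_mul_const, intervalIntegral.integral_mul_const,
      intervalIntegral.integral_const_mul, intervalIntegral.integral_const_mul,
      intervalIntegral.integral_const, hid, hAe, hIp, smul_eq_mul, intervalIntegral.integral_mul_const, hid] at h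
    linarith
  have h := intervalIntegral.integral_mono_on_of_le_Ioo (μ := volume) (a := 0) (b := 1/2)
      (f := fun b => (1/8) * g (1/2) + b * (1/2 * g (1/2)))
      (g := fun b => b * A + 1/8 * g (1/2 + b) + (c * L * P) * b ^ q)
      (by norm_num)
      (intervalIntegrable_const.add (hidi.mul_const _))
      (((hidi.mul_const _).add (hB.const_mul _)).add (hiq.const_mul _))
      hstep
  rw [intervalIntegral.integral_add intervalIntegrable_const (hidi.mul_const _),
      intervalIntegral.integral_add ((hidi.mul_const _).add (hB.const_mul _)) (hiq.const_mul _),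
      intervalIntegral.integral_add (hidi.mul_const _) (hB.const_mul _),
      intervalIntegral.integral_mul_const, intervalIntegral.integral_mul_const,
      intervalIntegral.integral_const_mul, intervalIntegral.integral_const_mul,
      intervalIntegral.integral_const, hid, hBe, hIq, smul_eq_mul, intervalIntegral.integral_mul_const, hid] at h
  have hfin : c * L / ((2:ℝ) ^ (p + q - 1) * (p + 1) * (q + 1)) = 8 * (c * L * P * Q) := by
    have h2 : (0:ℝ) < 2 := by norm_num
    have hPp : (2:ℝ) ^ p ≠ 0 := (Real.rpow_pos_of_pos h2 p).ne'
    have hQp : (2:ℝ) ^ q ≠ 0 := (Real.rpow_pos_of_pos h2 q).ne'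
    rw [hPdef, hQdef, Real.div_rpow zero_le_one h2.le, Real.div_rpow zero_le_one h2.le,
      Real.one_rpow, Real.one_rpow, Real.rpow_sub h2, Real.rpow_add h2, Real.rpow_add h2,
      Real.rpow_add h2, Real.rpow_one]
    field_simp
    norm_num
  rw [hmid, hfin]
  change g (1/2) ≤ (∫ t in (0:ℝ)..1, g t) + _
  rw [← hsum]
  linarith
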